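/- arXiv:2009.05095 — 2 statements merged into one kernel-verified Lean document; each statement's English description precedes it below -/
import Mathlib

section
/- Let A be a traceless operator on the first k' sites with ‖A‖ = 1, and suppose H_N ≠ 0 for some sufficiently large N, so that the N-independent constant τ_h = tr(H_N h)/d is positive; let τ_A = tr(H_N A)/d (also N-independent for large N). Assume the following eigenstate thermalization hypothesis: there are constants ε ∈ (0,1), M ≥ 0, K ≥ 0 and, for each N, a function g_N : [−ε,ε] → {z ∈ ℂ : |z| ≤ 1} together with complex numbers a_N, b_N, c_N with |a_N|, |b_N|, |c_N| ≤ M such that |g_N(x) − a_N − b_N x − (c_N/2)x²| ≤ M|x|³ for all x ∈ [−ε,ε], and |⟨j|A|j⟩ − g_N(E_j/N)| ≤ K/N² for every j with |E_j| ≤ Nε. Then, for the linear function f(x) = (τ_A/τ_h)·x, there is a constant C such that r_f(N) ≤ C/N for all sufficiently large N. -/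
open Matrix MeasureTheory Filter

/-- The space of operators on a chain of `N` qudits, each of local dimension `dloc`. -/
abbrev Op (dloc N : ℕ) := Matrix (Fin N → Fin dloc) (Fin N → Fin dloc) ℂ

/-- Cyclic translation of qudit configurations: site `i` of the new configuration carries
the value of site `i - 1` of the old one. -/
def confShift (dloc N : ℕ) : Equiv.Perm (Fin N → Fin dloc) :=
  Equiv.arrowCongr (finRotate N) (Equiv.refl (Fin dloc))

/-- The translation operator `T` on a chain of `N` qudits, as a permutation matrix. -/
noncomputable def Tmat (dloc N : ℕ) : Op dloc N :=
  fun x y => if x = confShift dloc N y then 1 else 0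

/-- Extension of an operator on the first `m` sites to the `N`-site chain, by tensoring
with the identity on the remaining sites (the zero operator if `m > N`). -/
noncomputable def embed (dloc m N : ℕ) (a : Op dloc m) : Op dloc N :=
  if hm : m ≤ N then
    (fun x y => a (fun i => x (Fin.castLE hm i)) (fun i => y (Fin.castLE hm i)) *
      (if ∀ i : Fin N, m ≤ (i : ℕ) → x i = y i then 1 else 0))
  else 0

/-- The translation-invariant Hamiltonian `H_N = ∑_{l=0}^{N-1} T^l h T^{-l}` built from
a local term `h` on `k` sites. -/
noncomputable def Ham (dloc k N : ℕ) (h : Op dloc k) : Op dloc N :=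
  ∑ l : Fin N, Tmat dloc N ^ (l : ℕ) * embed dloc k N h * (Tmat dloc N)ᴴ ^ (l : ℕ)

/-- The operator norm (ℓ²→ℓ² norm) of a matrix. -/
noncomputable def opNorm {n : Type*} [Fintype n] [DecidableEq n] (A : Matrix n n ℂ) : ℝ :=
  ‖Matrix.toEuclideanCLM (𝕜 := ℂ) (n := n) A‖

/-- An orthonormal basis of simultaneous eigenvectors of the Hamiltonian `H` (with real
eigenvalues `E j`) and of the translation operator `T` (with eigenvalues `τ j`). -/
structure EigData (dloc N : ℕ) (H : Op dloc N) where
  v : (Fin N → Fin dloc) → ((Fin N → Fin dloc) → ℂ)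
  E : (Fin N → Fin dloc) → ℝ
  τ : (Fin N → Fin dloc) → ℂ
  orth : ∀ j j', star (v j) ⬝ᵥ v j' = if j = j' then 1 else 0
  eigH : ∀ j, H.mulVec (v j) = (E j : ℂ) • v j
  eigT : ∀ j, (Tmat dloc N).mulVec (v j) = τ j • v j

/-- The eigenstate expectation value `⟨j|B|j⟩`. -/
noncomputable def eev {dloc N : ℕ} {H : Op dloc N} (D : EigData dloc N H)
    (B : Op dloc N) (j : Fin N → Fin dloc) : ℂ :=
  star (D.v j) ⬝ᵥ B.mulVec (D.v j)

/-- `r_f(N) = ((1/d) ∑_j |⟨j|B|j⟩ - f(E_j/N)|²)^{1/2}`. -/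
noncomputable def rf {dloc N : ℕ} {H : Op dloc N} (D : EigData dloc N H)
    (B : Op dloc N) (f : ℝ → ℂ) : ℝ :=
  Real.sqrt ((1 / (dloc : ℝ) ^ N) * ∑ j, ‖eev D B j - f (D.E j / N)‖ ^ 2)

/-- A function `f : [-1,1] → {z : ℂ, |z| ≤ 1}` (encoded as a total function on `ℝ`)
is smooth with Taylor data `c0 = f(0)`, `c1 = f'(0)`, `c2 = f''(0)` and remainder
constant `M` if `|f(x) - c0 - c1 x - (c2/2) x²| ≤ M |x|³` on `[-1,1]`. -/
def SmoothFn (f : ℝ → ℂ) (c0 c1 c2 : ℂ) (M : ℝ) : Prop :=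
  0 ≤ M ∧ (∀ x ∈ Set.Icc (-1 : ℝ) 1, ‖f x‖ ≤ 1) ∧
    ∀ x ∈ Set.Icc (-1 : ℝ) 1, ‖f x - c0 - c1 * x - c2 / 2 * x ^ 2‖ ≤ M * |x| ^ 3

/-- The generalized Pauli string `X^{a_1}Z^{b_1} ⊗ ⋯ ⊗ X^{a_m}Z^{b_m}` on `m` qudits,
where `X|x⟩ = |x+1 mod dloc⟩` and `Z|x⟩ = ω^x |x⟩` with `ω = exp(2πi/dloc)`. -/
noncomputable def pauli (dloc m : ℕ) (a b : Fin m → Fin dloc) : Op dloc m :=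
  fun x y =>
    if ∀ i, (x i : ℕ) = ((y i : ℕ) + (a i : ℕ)) % dloc then
      ∏ i, Complex.exp (2 * Real.pi * Complex.I * (b i : ℕ) * (y i : ℕ) / dloc)
    else 0

/-- An operator on `k` sites is canonical if every generalized Pauli string with nonzero
coefficient in its expansion acts nontrivially on site 1. -/
def Canonical (dloc k : ℕ) (h : Op dloc k) : Prop :=
  ∀ a b : Fin k → Fin dloc,
    (∀ i : Fin k, (i : ℕ) = 0 → (a i : ℕ) = 0 ∧ (b i : ℕ) = 0) →
      Matrix.trace ((pauli dloc k a b)ᴴ * h) = 0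

/-- An operator on `k` sites is exactly `k`-local if some generalized Pauli string with
nonzero coefficient in its expansion acts nontrivially on site `k`. -/
def ExactlyLocal (dloc k : ℕ) (h : Op dloc k) : Prop :=
  ∃ a b : Fin k → Fin dloc, ∃ i : Fin k, (i : ℕ) = k - 1 ∧ ((a i : ℕ) ≠ 0 ∨ (b i : ℕ) ≠ 0) ∧
    Matrix.trace ((pauli dloc k a b)ᴴ * h) ≠ 0

/-- The submodule (over `ℝ`) of traceless operators on `k'` sites. -/
noncomputable def tracelessOps (dloc k' : ℕ) : Submodule ℝ (Op dloc k') :=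
  LinearMap.ker ((Matrix.traceLinearMap (Fin k' → Fin dloc) ℂ ℂ).restrictScalars ℝ)

/-- The translation average `𝔸 = (1/N) ∑_{l=0}^{N-1} T^l A T^{-l}` of an operator. -/
noncomputable def tavg (dloc N : ℕ) (A : Op dloc N) : Op dloc N :=
  ((N : ℂ))⁻¹ • ∑ l : Fin N, Tmat dloc N ^ (l : ℕ) * A * (Tmat dloc N)ᴴ ^ (l : ℕ)

/-- A linear functional on matrices that is invariant under cyclic permutations is a multiple
of the trace. -/
lemma tracial_functional_eq {n : Type*} [Fintype n] [DecidableEq n]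
    (f : Matrix n n ℂ →ₗ[ℂ] ℂ) (hf : ∀ a b, f (a * b) = f (b * a)) (a : Matrix n n ℂ) :
    f a * Fintype.card n = f 1 * a.trace := by
  have off : ∀ i j (z : ℂ), i ≠ j → f (Matrix.single i j z) = 0 := by
    intro i j z hij
    have h1 := hf (Matrix.single i j z) (Matrix.single j j 1)
    rw [Matrix.single_mul_single_same, Matrix.single_mul_single_of_ne _ _ _ _ hij.symm] at h1
    simpa using h1
  have diag : ∀ i j (z : ℂ), f (Matrix.single i i z) = z * f (Matrix.single j j 1) := by
    intro i j z
    have h1 := hf (Matrix.single i j z) (Matrix.single j i 1)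
    rw [Matrix.single_mul_single_same, Matrix.single_mul_single_same, mul_one, one_mul] at h1
    rw [h1, ← smul_eq_mul, ← map_smul, Matrix.smul_single, smul_eq_mul, mul_one]
  have expand : ∀ (b : Matrix n n ℂ) (j : n), f b = b.trace * f (Matrix.single j j 1) := by
    intro b j
    conv_lhs => rw [Matrix.matrix_eq_sum_single b]
    rw [map_sum, Matrix.trace, Finset.sum_mul]
    refine Finset.sum_congr rfl fun i _ => ?_
    rw [map_sum, Finset.sum_eq_single i (fun l _ hl => off i l _ hl.symm) (by simp)]
    exact diag i j _
  rcases isEmpty_or_nonempty n with hn | ⟨⟨j⟩⟩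
  · simp [Matrix.trace]
  · rw [expand a j, expand 1 j, Matrix.trace_one]
    ring

section Placement

variable {d m n N : ℕ}

/-- The operator `a` on `m` sites, placed at the sites `e 0, …, e (m - 1)` of a chain of
`N` sites. -/
noncomputable def placeOp (e : Fin m → Fin N) (a : Op d m) : Op d N := by
  classical exact fun x y => if ∀ i, i ∉ Set.range e → x i = y i then a (x ∘ e) (y ∘ e) else 0

lemma embed_eq_placeOp (hm : m ≤ N) (a : Op d m) :
    embed d m N a = placeOp (Fin.castLE hm) a := by
  ext x y
  have hiff : (∀ i, i ∉ Set.range (Fin.castLE hm) → x i = y i) ↔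
      ∀ i : Fin N, m ≤ (i : ℕ) → x i = y i := by
    refine forall_congr' fun i => ?_
    rw [Fin.range_castLE]
    simp
  have hval : embed d m N a = fun x y => a (fun i => x (Fin.castLE hm i))
      (fun i => y (Fin.castLE hm i)) *
        (if ∀ i : Fin N, m ≤ (i : ℕ) → x i = y i then 1 else 0) := dif_pos hm
  rw [hval]
  simp only [placeOp, hiff]
  split_ifs <;> simp [Function.comp_def]

lemma sum_placeOp_mul {e : Fin m → Fin N} (he : Function.Injective e) (a : Op d m)
    (F : (Fin N → Fin d) → ℂ) (x : Fin N → Fin d) :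
    ∑ z, placeOp e a x z * F z = ∑ w, a (x ∘ e) w * F (Function.extend e w x) := by
  symm
  refine Finset.sum_of_injOn (fun w => Function.extend e w x)
    ((Function.extend_injective he x).injOn) (by simp [Set.MapsTo]) ?_ ?_
  · intro z _ hz
    have : ¬ ∀ i, i ∉ Set.range e → x i = z i := by
      intro hxz
      refine hz ⟨z ∘ e, by simp, ?_⟩
      funext i
      by_cases hi : ∃ j, e j = i
      · obtain ⟨j, rfl⟩ := hi
        simp [he.extend_apply]
      · simp only [Function.extend_apply' _ _ _ hi]
        exact hxz i hi
    simp only [placeOp, if_neg this, zero_mul]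
  · intro w _
    have : ∀ i, i ∉ Set.range e → x i = Function.extend e w x i := fun i hi =>
      (Function.extend_apply' _ _ _ hi).symm
    simp only [placeOp, if_pos this, Function.extend_comp he]

lemma placeOp_mul_apply {e : Fin m → Fin N} (he : Function.Injective e) (a : Op d m)
    (B : Op d N) (x y : Fin N → Fin d) :
    (placeOp e a * B) x y = ∑ w, a (x ∘ e) w * B (Function.extend e w x) y := by
  rw [Matrix.mul_apply, sum_placeOp_mul he]

lemma placeOp_extend_left {e : Fin m → Fin N} (he : Function.Injective e) (b : Op d m)
    (w : Fin m → Fin d) (x y : Fin N → Fin d) :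
    placeOp e b (Function.extend e w x) y =
      if ∀ i, i ∉ Set.range e → x i = y i then b w (y ∘ e) else 0 := by
  classical
  have hiff : (∀ i, i ∉ Set.range e → Function.extend e w x i = y i) ↔
      ∀ i, i ∉ Set.range e → x i = y i := by
    refine forall_congr' fun i => forall_congr' fun hi => ?_
    rw [Function.extend_apply' _ _ _ hi]
  simp only [placeOp, Function.extend_comp he]
  by_cases hc : ∀ i, i ∉ Set.range e → x i = y i
  · rw [if_pos (hiff.2 hc), if_pos hc]
  · rw [if_neg (fun hh => hc (hiff.1 hh)), if_neg hc]

lemma placeOp_mul {e : Fin m → Fin N} (he : Function.Injective e) (a b : Op d m) :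
    placeOp e (a * b) = placeOp e a * placeOp e b := by
  classical
  ext x y
  rw [placeOp_mul_apply he]
  simp only [placeOp_extend_left he]
  by_cases hc : ∀ i, i ∉ Set.range e → x i = y i
  · simp only [placeOp, if_pos hc, Matrix.mul_apply]
  · simp only [placeOp, if_neg hc, mul_zero, Finset.sum_const_zero]

lemma placeOp_one (e : Fin m → Fin N) : placeOp e (1 : Op d m) = 1 := by
  ext x y
  simp only [placeOp, Matrix.one_apply]
  by_cases hxy : x = y
  · simp [hxy]
  · simp only [if_neg hxy]
    split_ifs with h1 h2
    · refine absurd (funext fun i => ?_) hxy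
      by_cases hi : i ∈ Set.range e
      · obtain ⟨j, rfl⟩ := hi
        exact congrFun h2 j
      · exact h1 i hi
    · rfl
    · rfl

/-- Placement at an injective family of sites is a homomorphism of star algebras. -/
noncomputable def placeHom (e : Fin m → Fin N) (he : Function.Injective e) :
    Op d m →⋆ₐ[ℂ] Op d N where
  toFun := placeOp e
  map_one' := placeOp_one e
  map_mul' := placeOp_mul he
  map_zero' := by
    ext x y
    simp [placeOp]
  map_add' a b := by
    ext x y
    simp only [placeOp, Matrix.add_apply]
    split_ifs <;> simp
  commutes' r := by
    rw [Algebra.algebraMap_eq_smul_one, Algebra.algebraMap_eq_smul_one, ← placeOp_one e]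
    ext x y
    simp only [placeOp, Matrix.smul_apply]
    split_ifs <;> simp
  map_star' a := by
    ext x y
    simp only [placeOp, Matrix.star_apply, eq_comm (a := x _)]
    split_ifs <;> simp

@[simp] lemma placeHom_apply (e : Fin m → Fin N) (he : Function.Injective e) (a : Op d m) :
    placeHom e he a = placeOp e a := rfl

lemma placeOp_commute {e : Fin m → Fin N} {e' : Fin n → Fin N} (he : Function.Injective e)
    (he' : Function.Injective e') (hdisj : ∀ i j, e i ≠ e' j) (a : Op d m) (b : Op d n) :
    Commute (placeOp e a) (placeOp e' b) := by
  have key : ∀ {m n : ℕ} {e : Fin m → Fin N} {e' : Fin n → Fin N} (_ : Function.Injective e)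
      (_ : Function.Injective e') (_ : ∀ i j, e i ≠ e' j) (a : Op d m) (b : Op d n)
      (x y : Fin N → Fin d), (placeOp e a * placeOp e' b) x y = ∑ w, ∑ w',
        a (x ∘ e) w * (b (x ∘ e') w' *
          (1 : Op d N) (Function.extend e' w' (Function.extend e w x)) y) := by
    intro m n e e' he he' hdisj a b x y
    rw [placeOp_mul_apply he]
    refine Finset.sum_congr rfl fun w _ => ?_
    rw [← Finset.mul_sum, ← Matrix.mul_one (placeOp e' b), placeOp_mul_apply he']
    have : Function.extend e w x ∘ e' = x ∘ e' := by
      funext j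
      exact Function.extend_apply' _ _ _ fun ⟨i, hi⟩ => hdisj i j hi
    rw [this]
  have swap : ∀ (w : Fin m → Fin d) (w' : Fin n → Fin d) (x : Fin N → Fin d),
      Function.extend e' w' (Function.extend e w x) =
        Function.extend e w (Function.extend e' w' x) := by
    intro w w' x
    funext i
    by_cases hi : ∃ j, e j = i
    · obtain ⟨j, rfl⟩ := hi
      rw [Function.extend_apply' _ _ _ fun ⟨l, hl⟩ => hdisj j l hl.symm, he.extend_apply,
        he.extend_apply]
    · rw [Function.extend_apply' (f := e) _ _ _ hi]
      by_cases hi' : ∃ j, e' j = i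
      · obtain ⟨j, rfl⟩ := hi'
        rw [he'.extend_apply, he'.extend_apply]
      · rw [Function.extend_apply' _ _ _ hi', Function.extend_apply' _ _ _ hi',
          Function.extend_apply' _ _ _ hi]
  ext x y
  rw [key he he' hdisj, key he' he fun i j => (hdisj j i).symm, Finset.sum_comm]
  refine Finset.sum_congr rfl fun w' _ => Finset.sum_congr rfl fun w _ => ?_
  rw [swap]
  ring

lemma placeOp_comp {f : Fin n → Fin N} (hf : Function.Injective f) (e : Fin m → Fin n)
    (a : Op d m) : placeOp (f ∘ e) a = placeOp f (placeOp e a) := by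
  ext x y
  have hiff : (∀ i, i ∉ Set.range (f ∘ e) → x i = y i) ↔
      (∀ i, i ∉ Set.range f → x i = y i) ∧
        ∀ i, i ∉ Set.range e → (x ∘ f) i = (y ∘ f) i := by
    constructor
    · refine fun hh => ⟨fun i hi => hh i ?_, fun i hi => hh (f i) ?_⟩
      · rintro ⟨j, rfl⟩
        exact hi ⟨e j, rfl⟩
      · rintro ⟨j, hj⟩
        exact hi ⟨j, hf hj⟩
    · rintro ⟨h1, h2⟩ i hi
      by_cases hif : i ∈ Set.range f
      · obtain ⟨j, rfl⟩ := hif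
        refine h2 j ?_
        rintro ⟨l, rfl⟩
        exact hi ⟨l, rfl⟩
      · exact h1 i hif
  simp only [placeOp, hiff, ite_and]
  rfl

/-- A traceless operator times an operator commuting with everything on the same sites has
vanishing trace. -/
lemma trace_placeOp_mul_eq_zero {e : Fin m → Fin N} (he : Function.Injective e) {a : Op d m}
    (ha : a.trace = 0) (hd : d ≠ 0) {B : Op d N} (hB : ∀ b, Commute (placeOp e b) B) :
    (placeOp e a * B).trace = 0 := by
  have := tracial_functional_eq ((Matrix.traceLinearMap (Fin N → Fin d) ℂ ℂ).comp
    ((LinearMap.mulRight ℂ B).comp (placeHom e he).toLinearMap)) (fun b c => by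
      change (placeOp e (b * c) * B).trace = (placeOp e (c * b) * B).trace
      rw [placeOp_mul he, placeOp_mul he, Matrix.mul_assoc, (hB c).eq, ← Matrix.mul_assoc, Matrix.trace_mul_comm,
        ← Matrix.mul_assoc]) a
  rw [ha, mul_zero] at this
  refine (mul_eq_zero.1 this).resolve_right ?_
  simp [hd]

lemma trace_placeOp {e : Fin m → Fin N} (he : Function.Injective e) (a : Op d m) :
    (placeOp e a).trace * (d : ℂ) ^ m = (d : ℂ) ^ N * a.trace := by
  have := tracial_functional_eq ((Matrix.traceLinearMap (Fin N → Fin d) ℂ ℂ).comp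
    (placeHom e he).toLinearMap) (fun b c => by
      change (placeOp e (b * c)).trace = (placeOp e (c * b)).trace
      rw [placeOp_mul he, placeOp_mul he, Matrix.trace_mul_comm]) a
  simpa [placeOp_one] using this

end Placement

section Translation

variable {d m k N : ℕ}

/-- The sites `l, l + 1, …, l + m - 1` (modulo `N`) of a periodic chain of `N` sites. -/
def window (hm : m ≤ N) (l : ℕ) : Fin m → Fin N :=
  fun i => ⟨((i : ℕ) + l) % N, Nat.mod_lt _ (by have := i.2; omega)⟩

lemma window_injective (hm : m ≤ N) (l : ℕ) : Function.Injective (window hm l) := by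
  intro i j hij
  have h1 : ((i : ℕ) + l) ≡ ((j : ℕ) + l) [MOD N] := congrArg Fin.val hij
  exact Fin.ext ((Nat.ModEq.add_right_cancel' l h1).eq_of_lt_of_lt
    (i.2.trans_le hm) (j.2.trans_le hm))

lemma window_zero (hm : m ≤ N) : window hm 0 = Fin.castLE hm := by
  funext i
  exact Fin.ext (Nat.mod_eq_of_lt (i.2.trans_le hm))

lemma window_self (hm : m ≤ N) : window hm N = window hm 0 := by
  funext i
  exact Fin.ext (by simp [window])

lemma finRotate_comp_window (hm : m ≤ N) (l : ℕ) :
    finRotate N ∘ window hm l = window hm (l + 1) := by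
  funext i
  have : NeZero N := ⟨by have := i.2; omega⟩
  refine Fin.ext ?_
  simp only [Function.comp_apply, finRotate_apply, window, Fin.val_add, Fin.val_one']
  rw [← Nat.add_mod, add_assoc]

lemma castLE_comp_window {L : ℕ} (hm : m ≤ L) (hL : L ≤ N) {l : ℕ} (hl : m + l ≤ L) :
    window (hm.trans hL) l = Fin.castLE hL ∘ window hm l := by
  funext i
  refine Fin.ext ?_
  have := i.2
  simp only [Function.comp_apply, window, Fin.val_castLE]
  rw [Nat.mod_eq_of_lt (by omega), Nat.mod_eq_of_lt (by omega)]

lemma Tmat_mul_apply (B : Op d N) (x y : Fin N → Fin d) :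
    (Tmat d N * B) x y = B (x ∘ finRotate N) y := by
  have hiff : ∀ z, x = confShift d N z ↔ x ∘ finRotate N = z := by
    intro z
    rw [eq_comm, ← Equiv.eq_symm_apply, eq_comm]
    rfl
  simp [Matrix.mul_apply, Tmat, hiff]

lemma mul_Tmat_conjTranspose_apply (B : Op d N) (x y : Fin N → Fin d) :
    (B * (Tmat d N)ᴴ) x y = B x (y ∘ finRotate N) := by
  conv_lhs => rw [← Matrix.conjTranspose_conjTranspose B, ← Matrix.conjTranspose_mul,
    Matrix.conjTranspose_apply, Tmat_mul_apply, Matrix.conjTranspose_apply, star_star]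

lemma Tmat_mul_conjTranspose : Tmat d N * (Tmat d N)ᴴ = 1 := by
  ext x y
  rw [mul_Tmat_conjTranspose_apply, ← Matrix.mul_one (Tmat d N), Tmat_mul_apply]
  simp [Matrix.one_apply, (finRotate N).surjective.injective_comp_right.eq_iff]

lemma Tmat_conj_placeOp (e : Fin m → Fin N) (a : Op d m) :
    Tmat d N * placeOp e a * (Tmat d N)ᴴ = placeOp (finRotate N ∘ e) a := by
  ext x y
  rw [mul_Tmat_conjTranspose_apply, Tmat_mul_apply]
  have hiff : (∀ i, i ∉ Set.range e → (x ∘ finRotate N) i = (y ∘ finRotate N) i) ↔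
      ∀ i, i ∉ Set.range (finRotate N ∘ e) → x i = y i := by
    rw [← (finRotate N).forall_congr_right
      (q := fun i => i ∉ Set.range (finRotate N ∘ e) → x i = y i)]
    simp
  simp only [placeOp, hiff]
  rfl

lemma Tmat_pow_conj_placeOp_window (hm : m ≤ N) (a : Op d m) (l : ℕ) :
    Tmat d N ^ l * placeOp (window hm 0) a * (Tmat d N)ᴴ ^ l = placeOp (window hm l) a := by
  induction l with
  | zero => simp
  | succ l ih =>
    rw [pow_succ', pow_succ, ← finRotate_comp_window, ← Tmat_conj_placeOp, ← ih]
    simp only [Matrix.mul_assoc]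

lemma Ham_eq_sum (hk : k ≤ N) (h : Op d k) :
    Ham d k N h = ∑ l ∈ Finset.range N, placeOp (window hk l) h := by
  rw [Ham, ← Fin.sum_univ_eq_sum_range (fun l => placeOp (window hk l) h)]
  refine Finset.sum_congr rfl fun l _ => ?_
  rw [embed_eq_placeOp hk, ← window_zero, Tmat_pow_conj_placeOp_window]

lemma Tmat_commute_Ham (hk : k ≤ N) (h : Op d k) : Commute (Tmat d N) (Ham d k N h) := by
  have hconj : Tmat d N * Ham d k N h * (Tmat d N)ᴴ = Ham d k N h := by
    simp only [Ham_eq_sum hk, Finset.mul_sum, Finset.sum_mul, Tmat_conj_placeOp,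
      finRotate_comp_window]
    have h1 := Finset.sum_range_succ (fun l => placeOp (window hk l) h) N
    rw [Finset.sum_range_succ', window_self] at h1
    exact add_right_cancel h1
  have h2 : (Tmat d N)ᴴ * Tmat d N = 1 := mul_eq_one_comm.1 Tmat_mul_conjTranspose
  calc Tmat d N * Ham d k N h = Tmat d N * Ham d k N h * ((Tmat d N)ᴴ * Tmat d N) := by
        rw [h2, Matrix.mul_one]
    _ = Ham d k N h * Tmat d N := by rw [← Matrix.mul_assoc, hconj]

lemma trace_Ham_mul_window (hk : k ≤ N) (h : Op d k) (hm : m ≤ N) (a : Op d m) (l : ℕ) :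
    (Ham d k N h * placeOp (window hm l) a).trace =
      (Ham d k N h * embed d m N a).trace := by
  induction l with
  | zero => rw [embed_eq_placeOp hm, window_zero]
  | succ l ih =>
    have h2 : (Tmat d N)ᴴ * Tmat d N = 1 := mul_eq_one_comm.1 Tmat_mul_conjTranspose
    rw [← ih, ← finRotate_comp_window, ← Tmat_conj_placeOp, Matrix.mul_assoc (Tmat d N),
      ← Matrix.mul_assoc, ← (Tmat_commute_Ham hk h).eq, Matrix.mul_assoc,
      Matrix.trace_mul_comm, Matrix.mul_assoc, Matrix.mul_assoc, h2, Matrix.mul_one]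

lemma trace_Ham_sq (hk : k ≤ N) (h : Op d k) :
    (Ham d k N h * Ham d k N h).trace = N * (Ham d k N h * embed d k N h).trace := by
  have : Ham d k N h * Ham d k N h =
      ∑ l ∈ Finset.range N, Ham d k N h * placeOp (window hk l) h := by
    rw [← Finset.mul_sum, ← Ham_eq_sum hk]
  rw [this, Matrix.trace_sum]
  simp [trace_Ham_mul_window hk]

/-- The correlation `tr (H_N A) / d` does not depend on `N` once the chain is long enough. -/
lemma exists_trace_Ham_mul_embed (hd : d ≠ 0) (h : Op d k) (htr : h.trace = 0) (A : Op d m) :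
    ∃ c : ℂ, ∀ N, 2 * k + m ≤ N → (Ham d k N h * embed d m N A).trace = (d : ℂ) ^ N * c := by
  have hkL : k ≤ 2 * k + m := by omega
  have hmL : m ≤ 2 * k + m := by omega
  refine ⟨(∑ l ∈ Finset.range (k + m),
    (placeOp (window hkL l) h * placeOp (window hmL k) A).trace) / (d : ℂ) ^ (2 * k + m), ?_⟩
  intro N hN
  have hkN := hkL.trans hN
  have hmN := hmL.trans hN
  have hd' : (d : ℂ) ^ (2 * k + m) ≠ 0 := pow_ne_zero _ (by exact_mod_cast hd)
  rw [← trace_Ham_mul_window hkN h hmN A k, Ham_eq_sum hkN, Finset.sum_mul, Matrix.trace_sum,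
    ← Finset.sum_subset (Finset.range_mono (show k + m ≤ N by omega)), Finset.sum_div,
    Finset.mul_sum]
  · refine Finset.sum_congr rfl fun l hl => ?_
    have hl' := Finset.mem_range.1 hl
    have hinj : Function.Injective (Fin.castLE hN) := Fin.castLE_injective hN
    rw [castLE_comp_window hkL hN (show k + l ≤ _ by omega),
      castLE_comp_window hmL hN (show m + k ≤ _ by omega), placeOp_comp hinj, placeOp_comp hinj,
      ← placeOp_mul hinj, ← mul_div_assoc, eq_div_iff hd', trace_placeOp hinj]
  · intro l hlN hl
    have hlN' := Finset.mem_range.1 hlN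
    have hl' : k + m ≤ l := by simpa using hl
    refine trace_placeOp_mul_eq_zero (window_injective _ _) htr hd fun b =>
      placeOp_commute (window_injective _ _) (window_injective _ _) (fun i j hij => ?_) _ _
    have hij' := congrArg Fin.val hij
    have hi := i.2
    have hj := j.2
    simp only [window] at hij'
    rw [Nat.mod_eq_of_lt (show (j : ℕ) + k < N by omega)] at hij'
    rcases lt_or_ge ((i : ℕ) + l) N with hlt | hge
    · rw [Nat.mod_eq_of_lt hlt] at hij'
      omega
    · rw [Nat.mod_eq_sub_mod hge, Nat.mod_eq_of_lt (by omega)] at hij'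
      omega

end Translation

section Moments

open scoped Matrix.Norms.L2Operator

lemma norm_dotProduct_mulVec_le {n : Type*} [Fintype n] [DecidableEq n] (B : Matrix n n ℂ)
    {v : n → ℂ} (hv : star v ⬝ᵥ v = 1) : ‖star v ⬝ᵥ B *ᵥ v‖ ≤ ‖B‖ := by
  have hinner : ∀ w : n → ℂ, star v ⬝ᵥ w = inner ℂ (WithLp.toLp 2 v) (WithLp.toLp 2 w) := by
    intro w
    rw [EuclideanSpace.inner_eq_star_dotProduct, dotProduct_comm]
  have hnorm : ‖WithLp.toLp 2 v‖ = 1 := by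
    have h1 : ((‖WithLp.toLp 2 v‖ : ℝ) : ℂ) ^ 2 = 1 := by
      rw [← hv, hinner, inner_self_eq_norm_sq_to_K]
      rfl
    have h2 : ‖WithLp.toLp 2 v‖ ^ 2 = 1 := by exact_mod_cast h1
    exact (pow_eq_one_iff_of_nonneg (norm_nonneg _) two_ne_zero).1 h2
  rw [hinner]
  refine (norm_inner_le_norm _ _).trans ?_
  have := Matrix.l2_opNorm_mulVec B (WithLp.toLp 2 v)
  rw [hnorm, mul_one] at this
  rw [hnorm, one_mul]
  exact this

lemma norm_trace_le {n : Type*} [Fintype n] [DecidableEq n] (B : Matrix n n ℂ) :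
    ‖B.trace‖ ≤ Fintype.card n * ‖B‖ := by
  refine (norm_sum_le _ _).trans ((Finset.sum_le_card_nsmul _ _ ‖B‖ fun i _ => ?_).trans ?_)
  · have := norm_dotProduct_mulVec_le B (v := Pi.single i 1) (by simp)
    simpa using this
  · simp

lemma norm_placeOp_le {d m N : ℕ} {e : Fin m → Fin N} (he : Function.Injective e)
    (a : Op d m) : ‖placeOp e a‖ ≤ opNorm a :=
  NonUnitalStarAlgHom.norm_apply_le (placeHom e he) a

/-- Fourth moment bound for a sum of matrices of norm at most one whose mixed fourth moments
vanish as soon as one of the four factors is unrelated to the others. -/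
lemma norm_trace_sum_pow_four_le {n ι : Type*} [Fintype n] [DecidableEq n] [Fintype ι]
    (X : ι → Matrix n n ℂ) (R : ι → ι → Prop) [DecidableRel R] (hsymm : ∀ p q, R p q → R q p)
    (hX : ∀ p, ‖X p‖ ≤ 1)
    (hzero : ∀ p q s t, ¬ R p q → ¬ R p s → ¬ R p t → (X p * (X q * X s * X t)).trace = 0)
    (c : ℝ) (hc : ∀ p, ∑ q, (if R p q then (1 : ℝ) else 0) ≤ c) :
    ‖((∑ p, X p) ^ 4).trace‖ ≤ Fintype.card n * (7 * (Fintype.card ι * c) ^ 2) := by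
  set r : ι → ι → ℝ := fun p q => if R p q then 1 else 0 with hr
  have hr0 : ∀ p q, 0 ≤ r p q := fun p q => by
    simp only [hr]
    split_ifs <;> norm_num
  have hexp : ((∑ p, X p) ^ 4).trace =
      ∑ p, ∑ q, ∑ s, ∑ t, (X p * (X q * X s * X t)).trace := by
    have : (∑ p, X p) ^ 4 = (∑ p, X p) * ((∑ p, X p) * (∑ p, X p) * (∑ p, X p)) := by
      simp only [pow_succ, pow_zero, one_mul, mul_assoc]
    have hcube : (∑ p, X p) * (∑ p, X p) * (∑ p, X p) =
        ∑ q, ∑ s, ∑ t, X q * X s * X t := by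
      rw [Finset.sum_mul_sum, Finset.sum_mul]
      refine Finset.sum_congr rfl fun q _ => ?_
      rw [Finset.sum_mul]
      exact Finset.sum_congr rfl fun s _ => Finset.mul_sum _ _ _
    rw [this, hcube, Finset.sum_mul, Matrix.trace_sum]
    refine Finset.sum_congr rfl fun p _ => ?_
    simp only [Finset.mul_sum, Matrix.trace_sum]
  have hone : ∀ p q s t, ‖(X p * (X q * X s * X t)).trace‖ ≤ Fintype.card n := by
    intro p q s t
    refine (norm_trace_le _).trans (mul_le_of_le_one_right (Nat.cast_nonneg _) ?_)
    refine (norm_mul_le _ _).trans (mul_le_one₀ (hX p) (norm_nonneg _) ?_)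
    refine (norm_mul_le _ _).trans (mul_le_one₀ ?_ (norm_nonneg _) (hX t))
    exact (norm_mul_le _ _).trans (mul_le_one₀ (hX q) (norm_nonneg _) (hX s))
  have hpt : ∀ p q s t, ‖(X p * (X q * X s * X t)).trace‖ ≤ Fintype.card n *
      (r p q * r s t + r p s * r q t + r p t * r q s + r p s * r p t + r q s * r q t +
        r p s * r s t + r p t * r t s) := by
    intro p q s t
    have hcyc : ∀ p q s t, (X p * (X q * X s * X t)).trace =
        (X q * (X s * X t * X p)).trace := by
      intro p q s t
      rw [Matrix.trace_mul_comm]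
      simp only [Matrix.mul_assoc]
    have hs : ∀ p q, R p q ↔ R q p := fun p q => ⟨hsymm p q, hsymm q p⟩
    have hnn : 0 ≤ r p q * r s t + r p s * r q t + r p t * r q s + r p s * r p t +
        r q s * r q t + r p s * r s t + r p t * r t s := by
      have := fun a b c d => mul_nonneg (hr0 a b) (hr0 c d)
      have h1 := this p q s t
      have h2 := this p s q t
      have h3 := this p t q s
      have h4 := this p s p t
      have h5 := this q s q t
      have h6 := this p s s t
      have h7 := this p t t s
      positivity
    by_cases hall : (X p * (X q * X s * X t)).trace = 0
    · rw [hall, norm_zero]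
      exact mul_nonneg (Nat.cast_nonneg _) hnn
    · have e1 : R p q ∨ R p s ∨ R p t := by
        by_contra! hh
        exact hall (hzero p q s t hh.1 hh.2.1 hh.2.2)
      have e2 : R q s ∨ R q t ∨ R q p := by
        by_contra! hh
        exact hall ((hcyc p q s t).trans (hzero q s t p hh.1 hh.2.1 hh.2.2))
      have e3 : R s t ∨ R s p ∨ R s q := by
        by_contra! hh
        exact hall ((hcyc p q s t).trans ((hcyc q s t p).trans
          (hzero s t p q hh.1 hh.2.1 hh.2.2)))
      have e4 : R t p ∨ R t q ∨ R t s := by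
        by_contra! hh
        exact hall ((hcyc p q s t).trans ((hcyc q s t p).trans
          ((hcyc s t p q).trans (hzero t p q s hh.1 hh.2.1 hh.2.2))))
      refine (hone p q s t).trans (le_mul_of_one_le_right (Nat.cast_nonneg _) ?_)
      rw [hs q p] at e2
      rw [hs s p, hs s q] at e3
      rw [hs t p, hs t q, hs t s] at e4
      simp only [hr, hs t s]
      by_cases c1 : R p q <;> by_cases c2 : R p s <;> by_cases c3 : R p t <;>
        by_cases c4 : R q s <;> by_cases c5 : R q t <;> by_cases c6 : R s t <;>
        simp only [c1, c2, c3, c4, c5, c6, or_self, or_false, or_true, if_true, if_false] at e1 e2 e3 e4 ⊢ <;> norm_num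
  have hc0 : ∀ p : ι, 0 ≤ c := fun p => (Finset.sum_nonneg fun q _ => hr0 p q).trans (hc p)
  have hdouble : ∀ F : ι → ι → ι → ι → ℝ, (∀ p q, ∑ s, ∑ t, F p q s t ≤ c * c) →
      ∑ p, ∑ q, ∑ s, ∑ t, F p q s t ≤ (Fintype.card ι * c) ^ 2 := by
    intro F hF
    calc ∑ p, ∑ q, ∑ s, ∑ t, F p q s t ≤ ∑ _p : ι, ∑ _q : ι, c * c :=
          Finset.sum_le_sum fun p _ => Finset.sum_le_sum fun q _ => hF p q
      _ = (Fintype.card ι * c) ^ 2 := by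
          simp only [Finset.sum_const, Finset.card_univ, nsmul_eq_mul]
          ring
  have hprod : ∀ p q, (∑ s, r p s) * ∑ t, r q t ≤ c * c := fun p q =>
    mul_le_mul (hc p) (hc q) (Finset.sum_nonneg fun t _ => hr0 q t) (hc0 p)
  have hchain : ∀ p, ∑ s, ∑ t, r p s * r s t ≤ c * c := by
    intro p
    calc ∑ s, ∑ t, r p s * r s t ≤ ∑ s, r p s * c := Finset.sum_le_sum fun s _ => by
          rw [← Finset.mul_sum]
          exact mul_le_mul_of_nonneg_left (hc s) (hr0 p s)
      _ ≤ c * c := by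
          rw [← Finset.sum_mul]
          exact mul_le_mul_of_nonneg_right (hc p) (hc0 p)
  have b1 : ∑ p, ∑ q, ∑ s, ∑ t, r p q * r s t ≤ (Fintype.card ι * c) ^ 2 := by
    have htot : ∑ p, ∑ q, r p q ≤ Fintype.card ι * c :=
      (Finset.sum_le_sum fun p _ => hc p).trans (by simp)
    have htot0 : 0 ≤ ∑ p, ∑ q, r p q :=
      Finset.sum_nonneg fun p _ => Finset.sum_nonneg fun q _ => hr0 p q
    simp only [← Finset.mul_sum, ← Finset.sum_mul]
    rw [← sq]
    exact pow_le_pow_left₀ htot0 htot 2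
  have b2 := hdouble (fun p q s t => r p s * r q t) fun p q => by
    simpa only [← Finset.mul_sum, ← Finset.sum_mul] using hprod p q
  have b3 := hdouble (fun p q s t => r p t * r q s) fun p q => by
    simpa only [← Finset.mul_sum, ← Finset.sum_mul] using hprod p q
  have b4 := hdouble (fun p _ s t => r p s * r p t) fun p q => by
    simpa only [← Finset.mul_sum, ← Finset.sum_mul] using hprod p p
  have b5 := hdouble (fun _ q s t => r q s * r q t) fun p q => by
    simpa only [← Finset.mul_sum, ← Finset.sum_mul] using hprod q q
  have b6 := hdouble (fun p _ s t => r p s * r s t) fun p _ => hchain p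
  have b7 := hdouble (fun p _ s t => r p t * r t s) fun p _ => by
    rw [Finset.sum_comm]
    exact hchain p
  rw [hexp]
  calc ‖∑ p, ∑ q, ∑ s, ∑ t, (X p * (X q * X s * X t)).trace‖
      ≤ ∑ p, ∑ q, ∑ s, ∑ t, Fintype.card n *
      (r p q * r s t + r p s * r q t + r p t * r q s + r p s * r p t + r q s * r q t +
        r p s * r s t + r p t * r t s) := by
        refine norm_sum_le_of_le _ fun p _ => norm_sum_le_of_le _ fun q _ =>
          norm_sum_le_of_le _ fun s _ => norm_sum_le_of_le _ fun t _ => hpt p q s t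
    _ ≤ Fintype.card n * (7 * (Fintype.card ι * c) ^ 2) := by
        simp only [← Finset.mul_sum _ _ (Fintype.card n : ℝ)]
        refine mul_le_mul_of_nonneg_left ?_ (Nat.cast_nonneg _)
        simp only [Finset.sum_add_distrib]
        linarith

lemma window_right_injective {m N : ℕ} (hm : m ≤ N) (i : Fin m) {l l' : ℕ} (hl : l < N)
    (hlt : l' < N) (h : window hm l i = window hm l' i) : l = l' := by
  have h1 : ((i : ℕ) + l) ≡ ((i : ℕ) + l') [MOD N] := congrArg Fin.val h
  exact (Nat.ModEq.add_left_cancel' _ h1).eq_of_lt_of_lt hl hlt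

/-- The fourth moment of the spectrum of a translation-invariant Hamiltonian with traceless
local term is at most of order `N ^ 2`. -/
lemma norm_trace_Ham_pow_four_le {d k N : ℕ} (hd : d ≠ 0) (hk : k ≤ N) (h : Op d k)
    (htr : h.trace = 0) (hnorm : opNorm h ≤ 1) :
    ‖(Ham d k N h ^ 4).trace‖ ≤ (d : ℝ) ^ N * (7 * ((N : ℝ) * (k * k)) ^ 2) := by
  classical
  rw [Ham_eq_sum hk, ← Fin.sum_univ_eq_sum_range (fun l => placeOp (window hk l) h)]
  have hinj := window_injective hk
  have := norm_trace_sum_pow_four_le (fun l : Fin N => placeOp (window hk l) h)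
    (fun l l' => ∃ i j, window hk l i = window hk l' j)
    (fun l l' ⟨i, j, hij⟩ => ⟨j, i, hij.symm⟩)
    (fun l => (norm_placeOp_le (hinj l) h).trans hnorm)
    (fun p q s t hq hs ht => by
      push Not at hq hs ht
      exact trace_placeOp_mul_eq_zero (hinj p) htr hd fun b =>
        ((placeOp_commute (hinj _) (hinj _) hq b h).mul_right
          (placeOp_commute (hinj _) (hinj _) hs b h)).mul_right
          (placeOp_commute (hinj _) (hinj _) ht b h))
    (k * k) (fun p => by
      calc ∑ q : Fin N, (if ∃ i j, window hk p i = window hk q j then (1 : ℝ) else 0)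
          ≤ ∑ q : Fin N, ∑ i, ∑ j, if window hk p i = window hk q j then (1 : ℝ) else 0 := by
            refine Finset.sum_le_sum fun q _ => ?_
            have hnn : ∀ i j, (0 : ℝ) ≤ if window hk p i = window hk q j then 1 else 0 :=
              fun i j => by split_ifs <;> norm_num
            split_ifs with hex
            · obtain ⟨i, j, hij⟩ := hex
              calc (1 : ℝ) = if window hk p i = window hk q j then 1 else 0 := by rw [if_pos hij]
                _ ≤ ∑ j, if window hk p i = window hk q j then (1 : ℝ) else 0 :=
                  Finset.single_le_sum (fun j _ => hnn i j) (Finset.mem_univ j)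
                _ ≤ _ := Finset.single_le_sum
                  (f := fun i => ∑ j, if window hk p i = window hk q j then (1 : ℝ) else 0)
                  (fun i _ => Finset.sum_nonneg fun j _ => hnn i j) (Finset.mem_univ i)
            · exact Finset.sum_nonneg fun i _ => Finset.sum_nonneg fun j _ => hnn i j
        _ = ∑ i, ∑ j, ∑ q : Fin N, if window hk p i = window hk q j then (1 : ℝ) else 0 := by
            rw [Finset.sum_comm]
            exact Finset.sum_congr rfl fun i _ => Finset.sum_comm
        _ ≤ ∑ _i : Fin k, ∑ _j : Fin k, (1 : ℝ) := by
            refine Finset.sum_le_sum fun i _ => Finset.sum_le_sum fun j _ => ?_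
            rw [Finset.sum_boole]
            norm_cast
            refine Finset.card_le_one.2 fun q hq q' hq' => Fin.ext ?_
            simp only [Finset.mem_filter, Finset.mem_univ, true_and] at hq hq'
            exact window_right_injective hk j q.2 q'.2 (hq.symm.trans hq')
        _ = k * k := by simp)
  simpa using this

end Moments

section Spectrum

variable {d N : ℕ} {H : Op d N}

lemma sum_eev (D : EigData d N H) (B : Op d N) : ∑ j, eev D B j = B.trace := by
  set V : Op d N := Matrix.of fun x j => D.v j x with hV
  have h1 : Vᴴ * V = 1 := by
    ext i j
    simpa [Matrix.mul_apply, Matrix.one_apply, dotProduct, hV] using D.orth i j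
  have h2 : V * Vᴴ = 1 := mul_eq_one_comm.1 h1
  have h3 : (Vᴴ * (B * V)).trace = ∑ j, eev D B j := by
    simp [Matrix.trace, Matrix.mul_apply, eev, dotProduct, Matrix.mulVec, hV]
  rw [← h3, Matrix.trace_mul_comm, Matrix.mul_assoc, h2, Matrix.mul_one]

lemma eev_mul_self (D : EigData d N H) (B : Op d N) (j : Fin N → Fin d) :
    eev D (B * H) j = D.E j * eev D B j := by
  rw [eev, ← Matrix.mulVec_mulVec, D.eigH, Matrix.mulVec_smul, dotProduct_smul, smul_eq_mul, eev]

lemma eev_one (D : EigData d N H) (j : Fin N → Fin d) : eev D 1 j = 1 := by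
  simp [eev, D.orth]

lemma eev_pow (D : EigData d N H) (p : ℕ) (j : Fin N → Fin d) :
    eev D (H ^ p) j = (D.E j : ℂ) ^ p := by
  induction p with
  | zero => simp [eev_one]
  | succ p ih => rw [pow_succ, eev_mul_self, ih, pow_succ']

lemma sum_energy_pow (D : EigData d N H) (p : ℕ) :
    ∑ j, (D.E j : ℂ) ^ p = (H ^ p).trace := by
  rw [← sum_eev D]
  simp only [eev_pow]

lemma norm_eev_embed_le {k : ℕ} (hk : k ≤ N) (D : EigData d N H) (A : Op d k)
    (j : Fin N → Fin d) : ‖eev D (embed d k N A) j‖ ≤ opNorm A := by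
  rw [embed_eq_placeOp hk]
  exact (norm_dotProduct_mulVec_le _ (by simp [D.orth])).trans
    (norm_placeOp_le (Fin.castLE_injective hk) A)

end Spectrum

/-- If `y` is centered, `x` is centered and real, and `ρ` is the regression coefficient of `y`
on `x`, then `ρ x` is the best affine approximation of `y`. -/
lemma sum_norm_sq_regression_le {ι : Type*} [Fintype ι] (x : ι → ℝ) (y : ι → ℂ) (ρ a b : ℂ)
    (hx : ∑ j, (x j : ℂ) = 0) (hy : ∑ j, y j = 0)
    (hxy : ∑ j, y j * x j = ρ * ∑ j, (x j : ℂ) ^ 2) :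
    ∑ j, ‖y j - ρ * x j‖ ^ 2 ≤ ∑ j, ‖y j - a - b * x j‖ ^ 2 := by
  have horth : ∑ j, (y j - ρ * x j) * (starRingEnd ℂ) (a + (b - ρ) * x j) = 0 := by
    have : ∀ j, (y j - ρ * x j) * (starRingEnd ℂ) (a + (b - ρ) * x j) =
        (starRingEnd ℂ) a * y j - (starRingEnd ℂ) a * ρ * x j +
          (starRingEnd ℂ) (b - ρ) * (y j * x j) -
          (starRingEnd ℂ) (b - ρ) * ρ * (x j : ℂ) ^ 2 := by
      intro j
      simp only [map_add, map_mul, Complex.conj_ofReal]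
      ring
    simp only [this, Finset.sum_sub_distrib, Finset.sum_add_distrib, ← Finset.mul_sum, hx, hy,
      hxy]
    ring
  have hre := congrArg Complex.re horth
  rw [Complex.re_sum, Complex.zero_re] at hre
  have hpt : ∀ j, ‖y j - a - b * x j‖ ^ 2 = ‖y j - ρ * x j‖ ^ 2 +
      ‖a + (b - ρ) * x j‖ ^ 2 -
        2 * ((y j - ρ * x j) * (starRingEnd ℂ) (a + (b - ρ) * x j)).re := by
    intro j
    rw [show y j - a - b * x j = (y j - ρ * x j) - (a + (b - ρ) * x j) by ring]
    simp only [← Complex.normSq_eq_norm_sq, Complex.normSq_sub]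
  simp only [hpt, Finset.sum_sub_distrib, Finset.sum_add_distrib, ← Finset.mul_sum, hre]
  have : 0 ≤ ∑ j, ‖a + (b - ρ) * x j‖ ^ 2 := Finset.sum_nonneg fun j _ => by positivity
  linarith

/-- A quantity of size at most one which has a second order Taylor expansion near the origin
differs from its affine part by `O(x²)`, uniformly in `x`. -/
lemma norm_sub_affine_le {ε M δ x : ℝ} {y g a b c : ℂ} (hε : 0 < ε) (hε1 : ε < 1) (hM : 0 ≤ M)
    (hδ : 0 ≤ δ) (hy : ‖y‖ ≤ 1) (ha : ‖a‖ ≤ M) (hb : ‖b‖ ≤ M) (hc : ‖c‖ ≤ M)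
    (htaylor : |x| ≤ ε → ‖g - a - b * x - c / 2 * x ^ 2‖ ≤ M * |x| ^ 3)
    (hyg : |x| ≤ ε → ‖y - g‖ ≤ δ) :
    ‖y - a - b * x‖ ≤ (2 * M + (1 + 2 * M) / ε ^ 2) * x ^ 2 + δ := by
  have hx2 : |x| ^ 2 = x ^ 2 := sq_abs x
  have hx0 := abs_nonneg x
  rcases le_or_gt |x| ε with hx | hx
  · have h1 : y - a - b * x =
        (y - g) + (g - a - b * x - c / 2 * x ^ 2) + c / 2 * x ^ 2 := by ring
    have h2 : ‖c / 2 * (x : ℂ) ^ 2‖ ≤ M * x ^ 2 := by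
      rw [norm_mul, norm_div, norm_pow, Complex.norm_real, Real.norm_eq_abs, hx2]
      have : ‖(2 : ℂ)‖ = 2 := by norm_num
      rw [this]
      gcongr
      linarith
    have h3 : M * |x| ^ 3 ≤ M * x ^ 2 := by
      rw [← hx2]
      gcongr M * ?_
      exact pow_le_pow_of_le_one hx0 (by linarith) (by norm_num)
    have h4 : 0 ≤ (1 + 2 * M) / ε ^ 2 * x ^ 2 := by positivity
    rw [h1]
    have h5 := norm_add₃_le (a := y - g) (b := g - a - b * x - c / 2 * x ^ 2)
      (c := c / 2 * (x : ℂ) ^ 2)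
    have h6 := hyg hx
    have h7 := htaylor hx
    linarith
  · have h1 : 1 ≤ x ^ 2 / ε ^ 2 := by
      rw [one_le_div (by positivity), ← hx2]
      gcongr
    have h2 : |x| ≤ x ^ 2 / ε ^ 2 := by
      rw [le_div_iff₀ (by positivity), ← hx2, sq |x|]
      gcongr
      nlinarith
    have h3 : ‖b * (x : ℂ)‖ ≤ M * |x| := by
      rw [norm_mul, Complex.norm_real, Real.norm_eq_abs]
      gcongr
    have h4 : ‖y - a - b * x‖ ≤ ‖y‖ + ‖a‖ + ‖b * (x : ℂ)‖ :=
      (norm_sub_le _ _).trans (by gcongr; exact norm_sub_le _ _)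
    have h5 : M * |x| ≤ M * (x ^ 2 / ε ^ 2) := by gcongr
    have h6 : M ≤ M * (x ^ 2 / ε ^ 2) := le_mul_of_one_le_right hM h1
    have h7 : (1 + 2 * M) / ε ^ 2 * x ^ 2 =
        x ^ 2 / ε ^ 2 + M * (x ^ 2 / ε ^ 2) + M * (x ^ 2 / ε ^ 2) := by ring
    have h8 : 0 ≤ 2 * M * x ^ 2 := by positivity
    linarith

/-- Under the ETH ansatz, for the linear target function `f(x) = (τ_A/τ_h) x`
(where `τ_A = tr(H_N A)/d` and `τ_h = tr(H_N h)/d` are `N`-independent for large `N`),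
one has `r_f(N) ≤ C/N` for all sufficiently large `N`. -/
theorem eth_implies_rf_le (dloc k k' : ℕ) (hdloc : 2 ≤ dloc) (hk : 1 ≤ k)
    (h : Op dloc k) (hherm : h.IsHermitian) (htr : h.trace = 0) (hnorm : opNorm h = 1)
    (D : ∀ N, EigData dloc N (Ham dloc k N h))
    (hH : ∀ N₀ : ℕ, ∃ N : ℕ, N₀ ≤ N ∧ Ham dloc k N h ≠ 0)
    (A : Op dloc k') (hAtr : A.trace = 0) (hAnorm : opNorm A = 1)
    (ε M K : ℝ) (hε : ε ∈ Set.Ioo (0 : ℝ) 1) (hM : 0 ≤ M) (hK : 0 ≤ K)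
    (g : ℕ → ℝ → ℂ) (a b c : ℕ → ℂ)
    (hgbd : ∀ N : ℕ, ∀ x ∈ Set.Icc (-ε) ε, ‖g N x‖ ≤ 1)
    (habc : ∀ N : ℕ, ‖a N‖ ≤ M ∧ ‖b N‖ ≤ M ∧ ‖c N‖ ≤ M)
    (htaylor : ∀ N : ℕ, ∀ x ∈ Set.Icc (-ε) ε,
      ‖g N x - a N - b N * x - c N / 2 * x ^ 2‖ ≤ M * |x| ^ 3)
    (heth : ∀ N : ℕ, ∀ j, |(D N).E j| ≤ N * ε →
      ‖eev (D N) (embed dloc k' N A) j - g N ((D N).E j / N)‖ ≤ K / (N : ℝ) ^ 2) :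
    ∃ ρ : ℂ,
      (∃ N₁ : ℕ, ∀ N : ℕ, N₁ ≤ N →
        ρ = (Ham dloc k N h * embed dloc k' N A).trace /
          (Ham dloc k N h * embed dloc k N h).trace) ∧
      ∃ C : ℝ, ∃ N₀ : ℕ, ∀ N : ℕ, N₀ ≤ N →
        rf (D N) (embed dloc k' N A) (fun x => ρ * (x : ℂ)) ≤ C / N := by
  have hd : dloc ≠ 0 := by omega
  obtain ⟨cA, hcA⟩ := exists_trace_Ham_mul_embed hd h htr A
  obtain ⟨ch, hch⟩ := exists_trace_Ham_mul_embed hd h htr h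
  refine ⟨cA / ch, ⟨3 * k + k', fun N hN => ?_⟩, ?_⟩
  · rw [hcA N (by omega), hch N (by omega),
      mul_div_mul_left _ _ (pow_ne_zero N (Nat.cast_ne_zero.2 hd))]
  set L : ℝ := 2 * M + (1 + 2 * M) / ε ^ 2
  refine ⟨Real.sqrt (2 * L ^ 2 * (7 * (k * k) ^ 2) + 2 * K ^ 2), 3 * k + k', fun N hN => ?_⟩
  have hkN : k ≤ N := by omega
  have hkN' : k' ≤ N := by omega
  have hN1 : (1 : ℝ) ≤ N := by exact_mod_cast (by omega : 1 ≤ N)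
  have hN0 : (N : ℝ) ≠ 0 := by positivity
  have hNC : (N : ℂ) ≠ 0 := by exact_mod_cast hN0
  have hdpos : (0 : ℝ) < (dloc : ℝ) ^ N := by positivity
  set x : (Fin N → Fin dloc) → ℝ := fun j => (D N).E j / N with hx
  set y := eev (D N) (embed dloc k' N A) with hy
  have hxC : ∀ j, (x j : ℂ) = (D N).E j / N := fun j => by simp [hx]
  have hsumE : ∑ j, ((D N).E j : ℂ) = 0 := by
    have := sum_energy_pow (D N) 1
    simp only [pow_one] at this
    rw [this, Ham_eq_sum hkN, Matrix.trace_sum]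
    refine Finset.sum_eq_zero fun l _ => ?_
    simpa using trace_placeOp_mul_eq_zero (window_injective hkN l) htr hd
      fun b => Commute.one_right _
  have hsumx : ∑ j, (x j : ℂ) = 0 := by
    simp only [hxC, ← Finset.sum_div, hsumE, zero_div]
  have hsumy : ∑ j, y j = 0 := by
    rw [hy, sum_eev, embed_eq_placeOp hkN']
    simpa using trace_placeOp_mul_eq_zero (Fin.castLE_injective hkN') hAtr hd
      fun b => Commute.one_right _
  have hsumE2 : ∑ j, ((D N).E j : ℂ) ^ 2 = N * ((dloc : ℂ) ^ N * ch) := by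
    rw [sum_energy_pow, sq, trace_Ham_sq hkN, hch N (by omega)]
  have hsumyE : ∑ j, ((D N).E j : ℂ) * y j = (dloc : ℂ) ^ N * cA := by
    rw [← hcA N (by omega), Matrix.trace_mul_comm, ← sum_eev (D N)]
    simp only [eev_mul_self, hy]
  have hreg : ∑ j, y j * x j = cA / ch * ∑ j, (x j : ℂ) ^ 2 := by
    have e1 : ∑ j, y j * x j = (∑ j, ((D N).E j : ℂ) * y j) / N := by
      rw [Finset.sum_div]
      exact Finset.sum_congr rfl fun j _ => by rw [hxC]; ring
    have e2 : ∑ j, (x j : ℂ) ^ 2 = (∑ j, ((D N).E j : ℂ) ^ 2) / N ^ 2 := by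
      rw [Finset.sum_div]
      exact Finset.sum_congr rfl fun j _ => by rw [hxC]; ring
    by_cases hc0 : ch = 0
    · have hz : ∑ j, (D N).E j ^ 2 = 0 := by
        rw [hc0, mul_zero, mul_zero] at hsumE2
        exact_mod_cast hsumE2
      have hE : ∀ j, (D N).E j = 0 := fun j => by
        have := (Finset.sum_eq_zero_iff_of_nonneg fun j _ => sq_nonneg ((D N).E j)).1 hz j
          (Finset.mem_univ j)
        exact pow_eq_zero_iff two_ne_zero |>.1 this
      simp [hxC, hE]
    · rw [e1, e2, hsumE2, hsumyE]
      field_simp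
  have hx4 : ∑ j, x j ^ 4 ≤ (dloc : ℝ) ^ N * (7 * (k * k) ^ 2 / N ^ 2) := by
    have h4 := norm_trace_Ham_pow_four_le hd hkN h htr hnorm.le
    rw [← sum_energy_pow (D N)] at h4
    have h5 : ∑ j, (D N).E j ^ 4 ≤ (dloc : ℝ) ^ N * (7 * ((N : ℝ) * (k * k)) ^ 2) := by
      refine (le_abs_self _).trans ((le_of_eq ?_).trans h4)
      rw [← Real.norm_eq_abs, ← Complex.norm_real]
      push_cast
      rfl
    have h6 : ∑ j, x j ^ 4 = (∑ j, (D N).E j ^ 4) / N ^ 4 := by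
      rw [Finset.sum_div]
      exact Finset.sum_congr rfl fun j _ => div_pow _ _ _
    rw [h6, div_le_iff₀ (by positivity)]
    refine h5.trans (le_of_eq ?_)
    field_simp
  have hres : ∀ j, ‖y j - a N - b N * x j‖ ^ 2 ≤
      2 * L ^ 2 * x j ^ 4 + 2 * (K / (N : ℝ) ^ 2) ^ 2 := by
    intro j
    have h1 := norm_sub_affine_le (x := x j) (g := g N (x j)) hε.1 hε.2 hM
      (show 0 ≤ K / (N : ℝ) ^ 2 by positivity)
      ((norm_eev_embed_le hkN' (D N) A j).trans hAnorm.le) (habc N).1 (habc N).2.1 (habc N).2.2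
      (fun hxj => htaylor N (x j) (abs_le.1 hxj))
      (fun hxj => heth N j (by
        rwa [hx, abs_div, Nat.abs_cast, div_le_iff₀' (by positivity)] at hxj))
    calc ‖y j - a N - b N * x j‖ ^ 2 ≤ (L * x j ^ 2 + K / (N : ℝ) ^ 2) ^ 2 :=
          pow_le_pow_left₀ (norm_nonneg _) h1 2
      _ ≤ 2 * ((L * x j ^ 2) ^ 2 + (K / (N : ℝ) ^ 2) ^ 2) := add_sq_le
      _ = _ := by ring
  have hmain : ∑ j, ‖y j - cA / ch * x j‖ ^ 2 ≤
      (dloc : ℝ) ^ N * ((2 * L ^ 2 * (7 * (k * k) ^ 2) + 2 * K ^ 2) / N ^ 2) := by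
    have hK4 : (K / (N : ℝ) ^ 2) ^ 2 ≤ K ^ 2 / N ^ 2 := by
      rw [div_pow]
      gcongr
      exact le_self_pow₀ hN1 two_ne_zero
    calc ∑ j, ‖y j - cA / ch * x j‖ ^ 2 ≤ ∑ j, ‖y j - a N - b N * x j‖ ^ 2 :=
          sum_norm_sq_regression_le x y _ _ _ hsumx hsumy hreg
      _ ≤ ∑ j, (2 * L ^ 2 * x j ^ 4 + 2 * (K / (N : ℝ) ^ 2) ^ 2) :=
          Finset.sum_le_sum fun j _ => hres j
      _ = 2 * L ^ 2 * ∑ j, x j ^ 4 + (dloc : ℝ) ^ N * (2 * (K / (N : ℝ) ^ 2) ^ 2) := by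
          rw [Finset.sum_add_distrib, ← Finset.mul_sum]
          simp
      _ ≤ 2 * L ^ 2 * ((dloc : ℝ) ^ N * (7 * (k * k) ^ 2 / N ^ 2)) +
          (dloc : ℝ) ^ N * (2 * (K ^ 2 / N ^ 2)) := by gcongr
      _ = _ := by ring
  rw [rf, ← Real.sqrt_sq (Nat.cast_nonneg N : (0 : ℝ) ≤ N), ← Real.sqrt_div' _ (by positivity)]
  refine Real.sqrt_le_sqrt ?_
  rw [one_div, inv_mul_le_iff₀ hdpos, Real.sqrt_sq (Nat.cast_nonneg N)]
  exact hmain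
end

section
/- Let A be a traceless operator on the first k' sites. Then (1/d) tr(H_N² A) is independent of N for N ≥ 2k + k' − 2; that is, for all N₁, N₂ ≥ 2k + k' − 2, tr(H_{N₁}² A)/d_loc^{N₁} = tr(H_{N₂}² A)/d_loc^{N₂}. -/
open Matrix MeasureTheory Filter

open scoped Kronecker

section Place

variable {D α β γ ι κ : Type*}

open Classical in
/-- The operator `a` acting on the sites `f s`, `s : α`, tensored with the identity elsewhere. -/
noncomputable def place (f : α → ι) (a : Matrix (α → D) (α → D) ℂ) :
    Matrix (ι → D) (ι → D) ℂ :=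
  fun x y => a (x ∘ f) (y ∘ f) * if ∀ i, i ∉ Set.range f → x i = y i then 1 else 0

theorem place_place {g : κ → ι} (hg : Function.Injective g) (f : α → κ)
    (a : Matrix (α → D) (α → D) ℂ) : place g (place f a) = place (g ∘ f) a := by
  classical
  ext x y
  have key : (∀ i, i ∉ Set.range (g ∘ f) → x i = y i) ↔
      (∀ i, i ∉ Set.range f → (x ∘ g) i = (y ∘ g) i) ∧
        ∀ i, i ∉ Set.range g → x i = y i := by
    constructor
    · refine fun H => ⟨fun i hi => H _ ?_, fun i hi => H _ ?_⟩
      · rintro ⟨s, hs⟩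
        exact hi ⟨s, hg hs⟩
      · rintro ⟨s, hs⟩
        exact hi ⟨f s, hs⟩
    · rintro ⟨H₁, H₂⟩ i hi
      by_cases h : i ∈ Set.range g
      · obtain ⟨j, rfl⟩ := h
        refine H₁ j ?_
        rintro ⟨s, rfl⟩
        exact hi ⟨s, rfl⟩
      · exact H₂ i h
  simp only [place, key, ite_and, Function.comp_assoc, mul_assoc]
  split_ifs <;> simp

open Classical in
/-- Configurations on `ι` split into configurations on the sites `g s` and on the others. -/
noncomputable def splitConf (D : Type*) (g : κ → ι) (hg : Function.Injective g) :
    (ι → D) ≃ (κ → D) × ({i // i ∉ Set.range g} → D) :=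
  (Equiv.piEquivPiSubtypeProd (fun i => i ∈ Set.range g) (fun _ => D)).trans
    (Equiv.prodCongr (Equiv.arrowCongr (Equiv.ofInjective g hg).symm (Equiv.refl D))
      (Equiv.refl _))

theorem splitConf_apply {g : κ → ι} (hg : Function.Injective g) (x : ι → D) :
    splitConf D g hg x = (x ∘ g, x ∘ Subtype.val) := rfl

theorem place_eq_submatrix {g : κ → ι} (hg : Function.Injective g)
    [DecidableEq ({i // i ∉ Set.range g} → D)]
    (a : Matrix (κ → D) (κ → D) ℂ) :
    place g a = (a ⊗ₖ (1 : Matrix ({i // i ∉ Set.range g} → D) _ ℂ)).submatrix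
      (splitConf D g hg) (splitConf D g hg) := by
  ext x y
  have key : (∀ i, i ∉ Set.range g → x i = y i) ↔
      x ∘ (Subtype.val : {i // i ∉ Set.range g} → ι) = y ∘ Subtype.val := by
    simp [funext_iff]
  simp only [place, splitConf_apply, submatrix_apply, kroneckerMap_apply, Matrix.one_apply, key]

theorem place_compl_eq_submatrix {g : κ → ι} (hg : Function.Injective g) [DecidableEq (κ → D)]
    (b : Matrix ({i // i ∉ Set.range g} → D) ({i // i ∉ Set.range g} → D) ℂ) :
    place (Subtype.val : {i // i ∉ Set.range g} → ι) b =
      ((1 : Matrix (κ → D) _ ℂ) ⊗ₖ b).submatrix (splitConf D g hg) (splitConf D g hg) := by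
  ext x y
  have key : (∀ i, i ∉ Set.range (Subtype.val : {i // i ∉ Set.range g} → ι) → x i = y i) ↔
      x ∘ g = y ∘ g := by
    simp [funext_iff]
  simp only [place, splitConf_apply, submatrix_apply, kroneckerMap_apply, Matrix.one_apply, key]
  exact (mul_comm _ _).trans (congrArg₂ (· * ·) (if_congr Iff.rfl rfl rfl) rfl)

variable [DecidableEq D] [Fintype D] [Fintype ι] [DecidableEq ι] [Fintype κ] [DecidableEq κ]

theorem place_mul {g : κ → ι} (hg : Function.Injective g) (a b : Matrix (κ → D) (κ → D) ℂ) :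
    place g (a * b) = place g a * place g b := by
  classical
  simp only [place_eq_submatrix hg]
  rw [submatrix_mul_equiv, ← mul_kronecker_mul, one_mul]

theorem trace_submatrix_equiv {m n : Type*} [Fintype m] [Fintype n] (e : m ≃ n)
    (a : Matrix n n ℂ) : (a.submatrix e e).trace = a.trace :=
  Fintype.sum_equiv e _ _ fun _ => rfl

theorem trace_place {g : κ → ι} (hg : Function.Injective g) [Nonempty D]
    (a : Matrix (κ → D) (κ → D) ℂ) :
    (place g a).trace / (Fintype.card D : ℂ) ^ Fintype.card ι =
      a.trace / (Fintype.card D : ℂ) ^ Fintype.card κ := by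
  classical
  have hcard := Fintype.card_congr (splitConf D g hg)
  rw [Fintype.card_prod, Fintype.card_fun, Fintype.card_fun (α := κ)] at hcard
  rw [place_eq_submatrix hg, trace_submatrix_equiv, trace_kronecker, trace_one, ← Nat.cast_pow,
    hcard, Nat.cast_mul, Nat.cast_pow, mul_div_mul_right]
  exact Nat.cast_ne_zero.mpr Fintype.card_ne_zero

/-- The normalized trace of a product of local operators does not depend on the ambient sites. -/
theorem trace_place_comp {g : κ → ι} (hg : Function.Injective g) [Nonempty D]
    (u : α → κ) (v : β → κ) (w : γ → κ) (a : Matrix (α → D) (α → D) ℂ)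
    (b : Matrix (β → D) (β → D) ℂ) (c : Matrix (γ → D) (γ → D) ℂ) :
    (place (g ∘ u) a * place (g ∘ v) b * place (g ∘ w) c).trace /
        (Fintype.card D : ℂ) ^ Fintype.card ι =
      (place u a * place v b * place w c).trace / (Fintype.card D : ℂ) ^ Fintype.card κ := by
  rw [← place_place hg, ← place_place hg, ← place_place hg, ← place_mul hg, ← place_mul hg,
    trace_place hg]

/-- A traceless factor whose support is disjoint from the other supports kills the trace. -/
theorem trace_place_eq_zero {u : κ → ι} (hu : Function.Injective u) {v : β → ι} {w : γ → ι}
    {a : Matrix (κ → D) (κ → D) ℂ} (ha : a.trace = 0)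
    (b : Matrix (β → D) (β → D) ℂ) (c : Matrix (γ → D) (γ → D) ℂ)
    (huv : ∀ s t, u s ≠ v t) (huw : ∀ s t, u s ≠ w t) :
    (place u a * (place v b * place w c)).trace = 0 := by
  classical
  let v' : β → {i // i ∉ Set.range u} := fun t => ⟨v t, fun ⟨s, hs⟩ => huv s t hs⟩
  let w' : γ → {i // i ∉ Set.range u} := fun t => ⟨w t, fun ⟨s, hs⟩ => huw s t hs⟩
  have hv : place v b = place Subtype.val (place v' b) :=
    (place_place Subtype.val_injective v' b).symm
  have hw : place w c = place Subtype.val (place w' c) :=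
    (place_place Subtype.val_injective w' c).symm
  rw [hv, hw, ← place_mul Subtype.val_injective, place_eq_submatrix hu,
    place_compl_eq_submatrix hu, submatrix_mul_equiv, ← mul_kronecker_mul,
    trace_submatrix_equiv, mul_one, trace_kronecker, ha, zero_mul]

end Place

section Chain

/-- The site of the periodic chain of length `N` represented by an integer. -/
def site (N : ℕ) [NeZero N] (z : ℤ) : Fin N :=
  ⟨(z % N).toNat, by
    have := Int.emod_nonneg z (Int.natCast_ne_zero.mpr (NeZero.ne N))
    have := Int.emod_lt_of_pos z (Int.natCast_pos.mpr (NeZero.pos N))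
    omega⟩

theorem site_val {N : ℕ} [NeZero N] (z : ℤ) : ((site N z : ℕ) : ℤ) = z % N :=
  Int.toNat_of_nonneg (Int.emod_nonneg z (Int.natCast_ne_zero.mpr (NeZero.ne N)))

theorem site_eq_iff {N : ℕ} [NeZero N] {z w : ℤ} : site N z = site N w ↔ (N : ℤ) ∣ z - w := by
  rw [Fin.ext_iff, ← Int.natCast_inj, site_val, site_val, Int.emod_eq_emod_iff_emod_sub_eq_zero,
    Int.dvd_iff_emod_eq_zero]

theorem site_natCast {N : ℕ} [NeZero N] (i : Fin N) : site N (i : ℕ) = i := by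
  rw [Fin.ext_iff, ← Int.natCast_inj, site_val]
  exact Int.emod_eq_of_lt (by omega) (by omega)

theorem finRotate_site {N : ℕ} [NeZero N] (z : ℤ) :
    finRotate N (site N z) = site N (z + 1) := by
  rw [finRotate_apply]
  rw [Fin.ext_iff, ← Int.natCast_inj, Fin.val_add, site_val]
  push_cast
  rw [site_val, Fin.val_one']
  push_cast
  simp

theorem dvd_cases {N : ℕ} {z : ℤ} (h : (N : ℤ) ∣ z) : z = 0 ∨ (N : ℤ) ≤ z ∨ z ≤ -N := by
  rcases lt_trichotomy z 0 with hz | hz | hz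
  · have := Int.le_of_dvd (by omega) ((dvd_neg).mpr h)
    omega
  · exact Or.inl hz
  · exact Or.inr (Or.inl (Int.le_of_dvd hz h))

theorem site_injOn {N : ℕ} [NeZero N] {z w : ℤ} (h : site N z = site N w) (h₁ : z - w < N)
    (h₂ : w - z < N) : z = w := by
  have := dvd_cases (site_eq_iff.mp h)
  omega

/-- The sites `z, z + 1, …, z + m - 1` of the periodic chain. -/
def block (m N : ℕ) [NeZero N] (z : ℤ) (s : Fin m) : Fin N := site N (z + (s : ℕ))

theorem block_injective {m N : ℕ} [NeZero N] (hm : m ≤ N) (z : ℤ) :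
    Function.Injective (block m N z) := by
  intro s t hst
  have := site_injOn hst (by omega) (by omega)
  omega

variable {dloc : ℕ}

theorem embed_eq_place {m N : ℕ} [NeZero N] (hm : m ≤ N) (a : Op dloc m) :
    embed dloc m N a = place (block m N 0) a := by
  have hblock : block m N 0 = Fin.castLE hm := by
    funext s
    have := site_natCast (Fin.castLE hm s)
    simpa [block] using this
  ext x y
  have key : ∀ i : Fin N, i ∉ Set.range (Fin.castLE hm) ↔ m ≤ (i : ℕ) := by
    intro i
    simp [Fin.range_castLE]
  have hembed := congrFun₂ (dif_pos hm : embed dloc m N a = _) x y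
  refine hembed.trans ?_
  rw [hblock]
  simp only [place, key]
  exact congrArg₂ (· * ·) rfl (if_congr Iff.rfl rfl rfl)

theorem Tmat_mul_mul {N : ℕ} (M : Op dloc N) (x y : Fin N → Fin dloc) :
    (Tmat dloc N * M * (Tmat dloc N)ᴴ) x y = M (x ∘ finRotate N) (y ∘ finRotate N) := by
  have key : ∀ x z : Fin N → Fin dloc, x = confShift dloc N z ↔ z = x ∘ finRotate N := by
    intro x z
    constructor
    · rintro rfl
      funext i
      exact congrArg z ((finRotate N).symm_apply_apply i).symm
    · rintro rfl
      funext i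
      exact congrArg x ((finRotate N).apply_symm_apply i).symm
  simp [mul_apply, Tmat, conjTranspose_apply, key]

theorem conj_place {α : Type*} {N : ℕ} (f : α → Fin N)
    (a : Matrix (α → Fin dloc) (α → Fin dloc) ℂ) :
    Tmat dloc N * place f a * (Tmat dloc N)ᴴ = place (finRotate N ∘ f) a := by
  ext x y
  rw [Tmat_mul_mul]
  have key : (∀ i, i ∉ Set.range f → (x ∘ finRotate N) i = (y ∘ finRotate N) i) ↔
      ∀ i, i ∉ Set.range (finRotate N ∘ f) → x i = y i := by
    rw [← (finRotate N).forall_congr_right (q := fun i => i ∉ Set.range (finRotate N ∘ f) →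
      x i = y i)]
    simp
  unfold place
  refine congrArg₂ (· * ·) rfl ?_
  by_cases hxy : ∀ i, i ∉ Set.range (finRotate N ∘ f) → x i = y i
  · exact (if_pos (key.mpr hxy)).trans (if_pos hxy).symm
  · exact (if_neg (mt key.mp hxy)).trans (if_neg hxy).symm

theorem conj_pow_place {m N : ℕ} [NeZero N] (a : Op dloc m) (l : ℕ) :
    Tmat dloc N ^ l * place (block m N 0) a * (Tmat dloc N)ᴴ ^ l = place (block m N l) a := by
  induction l with
  | zero => simp
  | succ l ih =>
    have hblock : finRotate N ∘ block m N l = block m N (l + 1 : ℕ) := by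
      funext s
      simp only [Function.comp, block, finRotate_site]
      congr 1
      push_cast
      ring
    rw [pow_succ', pow_succ, ← hblock, ← conj_place, ← ih]
    simp only [mul_assoc]

theorem Ham_eq_sum_s5 {k N : ℕ} [NeZero N] (hk : k ≤ N) (h : Op dloc k) :
    Ham dloc k N h = ∑ l : Fin N, place (block k N (l : ℕ)) h := by
  simp only [Ham, embed_eq_place hk, conj_pow_place]

/-- The normalized trace of `h_z h_w A`, with `h_z` the copy of `h` starting at site `z`. -/
noncomputable def corr {k k' : ℕ} (h : Op dloc k) (A : Op dloc k') (N : ℕ) [NeZero N]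
    (z w : ℤ) : ℂ :=
  (place (block k N z) h * place (block k N w) h * place (block k' N 0) A).trace /
    (dloc : ℂ) ^ N

theorem block_congr {m N : ℕ} [NeZero N] {z w : ℤ} (hzw : site N z = site N w) :
    block m N z = block m N w := by
  funext s
  rw [site_eq_iff] at hzw
  refine site_eq_iff.mpr ?_
  simpa using hzw

theorem corr_congr {k k' N : ℕ} [NeZero N] (h : Op dloc k) (A : Op dloc k') {z w z' w' : ℤ}
    (hz : site N z = site N z') (hw : site N w = site N w') :
    corr h A N z w = corr h A N z' w' := by
  simp only [corr, block_congr hz, block_congr hw]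

theorem trace_Ham_sq_mul {k k' N : ℕ} [NeZero N] (hk : k ≤ N) (hk' : k' ≤ N)
    (h : Op dloc k) (A : Op dloc k') :
    (Ham dloc k N h ^ 2 * embed dloc k' N A).trace / (dloc : ℂ) ^ N =
      ∑ q : Fin N × Fin N, corr h A N (q.1 : ℕ) (q.2 : ℕ) := by
  rw [Ham_eq_sum_s5 hk, embed_eq_place hk', sq, Finset.sum_mul_sum, Fintype.sum_prod_type]
  simp only [Finset.sum_mul, trace_sum, Finset.sum_div, corr]

/-- At least two of the three pairs among `[z, z + k)`, `[w, w + k)`, `[0, k')` overlap. -/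
def Linked (k k' : ℕ) (q : ℤ × ℤ) : Prop :=
  (-(k : ℤ) < q.1 ∧ q.1 < k' ∧ -(k : ℤ) < q.2 ∧ q.2 < k') ∨
    (-(k : ℤ) < q.1 ∧ q.1 < k' ∧ q.1 - q.2 < k ∧ q.2 - q.1 < k) ∨
    (-(k : ℤ) < q.2 ∧ q.2 < k' ∧ q.1 - q.2 < k ∧ q.2 - q.1 < k)

open Classical in
/-- The finite set of linked pairs of positions. -/
noncomputable def linkedPairs (k k' : ℕ) : Finset (ℤ × ℤ) :=
  (Finset.Icc (-(2 * k : ℤ)) (k' + k) ×ˢ Finset.Icc (-(2 * k : ℤ)) (k' + k)).filter (Linked k k')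

theorem mem_linkedPairs {k k' : ℕ} {q : ℤ × ℤ} : q ∈ linkedPairs k k' ↔ Linked k k' q := by
  simp only [linkedPairs, Finset.mem_filter, Finset.mem_product, Finset.mem_Icc,
    and_iff_right_iff_imp, Linked]
  omega

theorem site_injOn_linkedPairs {k k' N : ℕ} [NeZero N] (hk : 1 ≤ k) (hk' : 1 ≤ k')
    (hN : 2 * k + k' - 2 ≤ N) :
    Set.InjOn (fun q : ℤ × ℤ => (site N q.1, site N q.2)) (linkedPairs k k') := by
  rintro ⟨a, b⟩ h₁ ⟨a', b'⟩ h₂ heq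
  simp only [Finset.mem_coe, mem_linkedPairs, Linked] at h₁ h₂
  simp only [Prod.mk.injEq, site_eq_iff] at heq
  have ha := dvd_cases heq.1
  have hb := dvd_cases heq.2
  rw [Prod.mk.injEq]
  omega

theorem corr_eq_of_linked {k k' N M : ℕ} [NeZero N] [NeZero M] (hdloc : 2 ≤ dloc) (hk : 1 ≤ k)
    (hk' : 1 ≤ k') (hN : 2 * k + k' - 2 ≤ N) (hM : 2 * k + k' - 2 ≤ M)
    (h : Op dloc k) (A : Op dloc k') {q : ℤ × ℤ} (hq : Linked k k' q) :
    corr h A N q.1 q.2 = corr h A M q.1 q.2 := by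
  obtain ⟨a, b⟩ := q
  have : Nonempty (Fin dloc) := ⟨⟨0, by omega⟩⟩
  let W : Finset ℤ := Finset.Ico (min a (min b 0)) (max (a + k) (max (b + k) k'))
  let u : Fin k → W := fun s => ⟨a + (s : ℕ), Finset.mem_Ico.mpr (by omega)⟩
  let v : Fin k → W := fun s => ⟨b + (s : ℕ), Finset.mem_Ico.mpr (by omega)⟩
  let w : Fin k' → W := fun s => ⟨0 + (s : ℕ), Finset.mem_Ico.mpr (by omega)⟩
  have key : ∀ (L : ℕ) [NeZero L], 2 * k + k' - 2 ≤ L → corr h A L a b =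
      (place u h * place v h * place w A).trace / (dloc : ℂ) ^ Fintype.card W := by
    intro L _ hL
    have hg : Function.Injective (fun z : W => site L z) := by
      rintro ⟨z₁, hz₁⟩ ⟨z₂, hz₂⟩ heq
      simp only [W, Finset.mem_Ico] at hz₁ hz₂
      simp only [Linked] at hq
      exact Subtype.ext (site_injOn heq (by dsimp only; omega) (by dsimp only; omega))
    have := trace_place_comp hg u v w h h A
    rw [Fintype.card_fin, Fintype.card_fin] at this
    exact this
  exact (key N hN).trans (key M hM).symm

theorem exists_lift_of_block_eq {m n N : ℕ} [NeZero N] {z w : ℤ} {s : Fin m} {t : Fin n}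
    (h : block m N z s = block n N w t) :
    ∃ z', site N z' = site N z ∧ z' - w < n ∧ w - z' < m := by
  refine ⟨w + (t : ℕ) - (s : ℕ), ?_, by omega, by omega⟩
  rw [block, block, site_eq_iff] at h
  obtain ⟨c, hc⟩ := h
  exact site_eq_iff.mpr ⟨-c, by linear_combination -hc⟩

theorem corr_eq_zero {k k' N : ℕ} [NeZero N] (hkN : k ≤ N) (hkN' : k' ≤ N)
    {h : Op dloc k} (htr : h.trace = 0) {A : Op dloc k'} (hA : A.trace = 0) {z w : ℤ}
    (hzw : ∀ q, Linked k k' q → ¬(site N q.1 = site N z ∧ site N q.2 = site N w)) :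
    corr h A N z w = 0 := by
  have hzA_wA : (∀ s t, block k N z s ≠ block k' N 0 t) ∨
      ∀ s t, block k N w s ≠ block k' N 0 t := by
    by_contra! hcon
    obtain ⟨⟨s, t, hst⟩, s', t', hst'⟩ := hcon
    obtain ⟨a, ha, ha₁, ha₂⟩ := exists_lift_of_block_eq hst
    obtain ⟨b, hb, hb₁, hb₂⟩ := exists_lift_of_block_eq hst'
    exact hzw (a, b) (by simp only [Linked]; omega) ⟨ha, hb⟩
  have hzA_zw : (∀ s t, block k N z s ≠ block k' N 0 t) ∨
      ∀ s t, block k N w s ≠ block k N z t := by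
    by_contra! hcon
    obtain ⟨⟨s, t, hst⟩, s', t', hst'⟩ := hcon
    obtain ⟨a, ha, ha₁, ha₂⟩ := exists_lift_of_block_eq hst
    rw [← block_congr ha] at hst'
    obtain ⟨b, hb, hb₁, hb₂⟩ := exists_lift_of_block_eq hst'
    exact hzw (a, b) (by simp only [Linked]; omega) ⟨ha, hb⟩
  have hwA_zw : (∀ s t, block k N w s ≠ block k' N 0 t) ∨
      ∀ s t, block k N z s ≠ block k N w t := by
    by_contra! hcon
    obtain ⟨⟨s, t, hst⟩, s', t', hst'⟩ := hcon
    obtain ⟨b, hb, hb₁, hb₂⟩ := exists_lift_of_block_eq hst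
    rw [← block_congr hb] at hst'
    obtain ⟨a, ha, ha₁, ha₂⟩ := exists_lift_of_block_eq hst'
    exact hzw (a, b) (by simp only [Linked]; omega) ⟨ha, hb⟩
  have hz := block_injective hkN z
  have hw := block_injective hkN w
  have h0 := block_injective hkN' 0
  rw [corr, div_eq_zero_iff]
  left
  rcases hzA_wA with hzA | hwA
  · rcases hwA_zw with hwA | hzw
    · rw [trace_mul_comm]
      exact trace_place_eq_zero h0 hA _ _ (fun s t => (hzA t s).symm) fun s t => (hwA t s).symm
    · rw [mul_assoc]
      exact trace_place_eq_zero hz htr _ _ hzw hzA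
  · rcases hzA_zw with hzA | hwz
    · rw [trace_mul_comm]
      exact trace_place_eq_zero h0 hA _ _ (fun s t => (hzA t s).symm) fun s t => (hwA t s).symm
    · rw [mul_assoc, trace_mul_comm, mul_assoc]
      exact trace_place_eq_zero hw htr _ _ hwA hwz

theorem sum_corr_eq_sum_linkedPairs {k k' N : ℕ} [NeZero N] (hk : 1 ≤ k) (hk' : 1 ≤ k')
    (hN : 2 * k + k' - 2 ≤ N) {h : Op dloc k} (htr : h.trace = 0) {A : Op dloc k'}
    (hA : A.trace = 0) :
    ∑ q ∈ linkedPairs k k', corr h A N q.1 q.2 =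
      ∑ q : Fin N × Fin N, corr h A N (q.1 : ℕ) (q.2 : ℕ) := by
  refine Finset.sum_of_injOn _ (site_injOn_linkedPairs hk hk' hN)
    (fun _ _ => Finset.mem_coe.mpr (Finset.mem_univ _)) (fun q _ hq => ?_) fun q _ => ?_
  · refine corr_eq_zero (by omega) (by omega) htr hA fun p hp hpq => hq ⟨p, ?_, ?_⟩
    · exact Finset.mem_coe.mpr (mem_linkedPairs.mpr hp)
    · rw [site_natCast, site_natCast] at hpq
      exact Prod.ext hpq.1 hpq.2
  · exact corr_congr h A (site_natCast _).symm (site_natCast _).symm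

end Chain

/-- For a traceless operator `A` on the first `k'` sites, `tr(H_N² A)/d` is
independent of `N` for `N ≥ 2k + k' - 2`. -/
theorem trace_HHA_eventually_const (dloc k k' : ℕ) (hdloc : 2 ≤ dloc) (hk : 1 ≤ k)
    (h : Op dloc k) (hherm : h.IsHermitian) (htr : h.trace = 0) (hnorm : opNorm h = 1)
    (A : Op dloc k') (hA : A.trace = 0) :
    ∀ N₁ N₂ : ℕ, 2 * k + k' - 2 ≤ N₁ → 2 * k + k' - 2 ≤ N₂ →
      (Ham dloc k N₁ h ^ 2 * embed dloc k' N₁ A).trace / (dloc : ℂ) ^ N₁ =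
        (Ham dloc k N₂ h ^ 2 * embed dloc k' N₂ A).trace / (dloc : ℂ) ^ N₂ := by
  intro N M hN hM
  rcases Nat.eq_zero_or_pos k' with rfl | hk'
  · have hA0 : A = 0 := by
      ext x y
      rw [trace, Fintype.sum_unique, diag_apply] at hA
      rw [Subsingleton.elim x default, Subsingleton.elim y default, hA, Matrix.zero_apply]
    have hembed : ∀ L, embed dloc 0 L (0 : Op dloc 0) = 0 := by
      intro L
      ext x y
      simp [embed]
    simp [hA0, hembed]
  · have : NeZero N := ⟨by omega⟩
    have : NeZero M := ⟨by omega⟩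
    rw [trace_Ham_sq_mul (by omega) (by omega), trace_Ham_sq_mul (by omega) (by omega),
      ← sum_corr_eq_sum_linkedPairs hk hk' hN htr hA,
      ← sum_corr_eq_sum_linkedPairs hk hk' hM htr hA]
    exact Finset.sum_congr rfl fun q hq =>
      corr_eq_of_linked hdloc hk hk' hN hM h A (mem_linkedPairs.mp hq)
end
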